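/- For each k ∈ ℕ, the function γ_k : [0,∞) → ℝ defined implicitly by Ψ_k^{γ_k(q),q} = 1 is well defined and satisfies: (1) γ_k is strictly decreasing on [0,∞); (2) γ_k is continuous on (0,∞); (3) γ_k(1) = 0 and γ_k(q) → −∞ as q → ∞; (4) γ_k is convex on (0,∞). -/

import Mathlib

open MeasureTheory Filter Set

attribute [local instance] Classical.propDecidable

noncomputable section

/-- Data of a box-like planar self-affine IFS: each map is `S i = T i ∘ L i + t i`, where
`T i` is the diagonal contraction `diag (c i, d i)` with `c i, d i ∈ (0,1)` and `L i` is a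
linear isometry of the plane preserving `[-1,1]²`, i.e. one of the eight symmetries of the
square, encoded by whether it swaps the two axes (`swap`) and by a sign on each coordinate. -/
structure IFSData (ι : Type) where
  c : ι → ℝ
  d : ι → ℝ
  swap : ι → Bool
  sgn1 : ι → Bool
  sgn2 : ι → Bool
  t : ι → ℝ × ℝ

namespace IFSData

variable {ι : Type}

/-- The affine contraction `S i = T i ∘ L i + t i`. -/
def S (B : IFSData ι) (i : ι) (x : ℝ × ℝ) : ℝ × ℝ :=
  ((if B.sgn1 i then 1 else -1) * (B.c i * (if B.swap i then x.2 else x.1)) + (B.t i).1,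
   (if B.sgn2 i then 1 else -1) * (B.d i * (if B.swap i then x.1 else x.2)) + (B.t i).2)

/-- `(b(i), h(i))`: base and height of the rectangle `S_i([0,1]²)` for a finite word `i`. -/
def dims (B : IFSData ι) (l : List ι) : ℝ × ℝ :=
  l.foldr (fun i w =>
    (B.c i * (if B.swap i then w.2 else w.1), B.d i * (if B.swap i then w.1 else w.2))) (1, 1)

/-- `α₁(i)`: the larger singular value of the linear part of `S_i`. -/
def alpha1 (B : IFSData ι) (l : List ι) : ℝ := max (B.dims l).1 (B.dims l).2

/-- `α₂(i)`: the smaller singular value of the linear part of `S_i`. -/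
def alpha2 (B : IFSData ι) (l : List ι) : ℝ := min (B.dims l).1 (B.dims l).2

/-- Whether the composite map of the word maps horizontal lines to vertical lines. -/
def swapW (B : IFSData ι) (l : List ι) : Bool := l.foldr (fun i b => xor (B.swap i) b) false

/-- The composite map `S_{i₁} ∘ ⋯ ∘ S_{i_k}` of a word. -/
def Sw (B : IFSData ι) (l : List ι) : ℝ × ℝ → ℝ × ℝ := l.foldr (fun i f => B.S i ∘ f) id

/-- The word `i` projects onto the first coordinate, i.e. `π_i = π₁`. -/
def usesPi1 (B : IFSData ι) (l : List ι) : Prop :=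
  (B.swapW l = false ∧ (B.dims l).2 ≤ (B.dims l).1) ∨
    (B.swapW l = true ∧ (B.dims l).1 < (B.dims l).2)

/-- The projection `π_i` onto the direction of the longest side of `S_i([0,1]²)`. -/
def projW (B : IFSData ι) (l : List ι) : ℝ × ℝ → ℝ :=
  if B.usesPi1 l then Prod.fst else Prod.snd

/-- The rectangular open set condition. -/
def ROSC (B : IFSData ι) : Prop :=
  ∃ x₁ x₂ y₁ y₂ : ℝ, x₁ < x₂ ∧ y₁ < y₂ ∧
    (∀ i, B.S i '' (Set.Ioo x₁ x₂ ×ˢ Set.Ioo y₁ y₂) ⊆ Set.Ioo x₁ x₂ ×ˢ Set.Ioo y₁ y₂) ∧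
    Pairwise fun i j =>
      Disjoint (B.S i '' (Set.Ioo x₁ x₂ ×ˢ Set.Ioo y₁ y₂))
        (B.S j '' (Set.Ioo x₁ x₂ ×ˢ Set.Ioo y₁ y₂))

end IFSData

/-- `p(i)`: the probability of a finite word. -/
def wordProb {ι : Type} (p : ι → ℝ) (l : List ι) : ℝ := (l.map p).prod

/-- `τ_i(q)`: the value of the `L^q`-spectrum of the projection `π_i μ`. -/
def tauW {ι : Type} (B : IFSData ι) (τ1 τ2 : ℝ → ℝ) (l : List ι) (q : ℝ) : ℝ :=
  if B.usesPi1 l then τ1 q else τ2 q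

/-- The `q`-modified singular value function `ψ^{s,q}`. -/
def psiSV {ι : Type} (B : IFSData ι) (p : ι → ℝ) (τ1 τ2 : ℝ → ℝ) (s q : ℝ) (l : List ι) : ℝ :=
  wordProb p l ^ q * B.alpha1 l ^ tauW B τ1 τ2 l q * B.alpha2 l ^ (s - tauW B τ1 τ2 l q)

/-- `Ψ_k^{s,q} = ∑_{i ∈ I^k} ψ^{s,q}(i)`. -/
def PsiSV {ι : Type} [Fintype ι] (B : IFSData ι) (p : ι → ℝ) (τ1 τ2 : ℝ → ℝ)
    (k : ℕ) (s q : ℝ) : ℝ :=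
  ∑ f : Fin k → ι, psiSV B p τ1 τ2 s q (List.ofFn f)

/-- The lower `L^q`-spectrum of a measure. -/
def lowerLq {X : Type*} [MeasurableSpace X] [PseudoMetricSpace X] (ν : Measure X) (q : ℝ) : ℝ :=
  liminf (fun δ : ℝ =>
      Real.log (∫ x, (ν (Metric.ball x δ)).toReal ^ (q - 1) ∂ν) / (-Real.log δ))
    (nhdsWithin 0 (Set.Ioi 0))

/-- The upper `L^q`-spectrum of a measure. -/
def upperLq {X : Type*} [MeasurableSpace X] [PseudoMetricSpace X] (ν : Measure X) (q : ℝ) : ℝ :=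
  limsup (fun δ : ℝ =>
      Real.log (∫ x, (ν (Metric.ball x δ)).toReal ^ (q - 1) ∂ν) / (-Real.log δ))
    (nhdsWithin 0 (Set.Ioi 0))

/-- The `L^q`-spectrum of `ν` exists and equals `t`. -/
def IsLqSpec {X : Type*} [MeasurableSpace X] [PseudoMetricSpace X]
    (ν : Measure X) (q t : ℝ) : Prop :=
  lowerLq ν q = t ∧ upperLq ν q = t

/-- `α_min = min_{i ∈ I} α₂(i)`. -/
def alphaMin {ι : Type} [Fintype ι] [Nonempty ι] (B : IFSData ι) : ℝ :=
  Finset.univ.inf' Finset.univ_nonempty fun i => min (B.c i) (B.d i)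

/-- `α_max = max_{i ∈ I} α₁(i)`. -/
def alphaMax {ι : Type} [Fintype ι] [Nonempty ι] (B : IFSData ι) : ℝ :=
  Finset.univ.sup' Finset.univ_nonempty fun i => max (B.c i) (B.d i)

/-- `p_max = max_{i ∈ I} p_i`. -/
def pMax {ι : Type} [Fintype ι] [Nonempty ι] (p : ι → ℝ) : ℝ :=
  Finset.univ.sup' Finset.univ_nonempty p

/-- The `δ`-stopping `I_δ`. -/
def stopping {ι : Type} (B : IFSData ι) (δ : ℝ) : Set (List ι) :=
  {l | l ≠ [] ∧ B.alpha2 l < δ ∧ δ ≤ B.alpha2 l.dropLast}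


lemma gamma_core {J : Type*} [Fintype J] [Nonempty J] (P A D : J → ℝ) (T : J → ℝ → ℝ)
    (hP : ∀ j, P j < 0) (hA : ∀ j, 0 ≤ A j) (hD : ∀ j, D j < 0)
    (hTa : ∀ j, AntitoneOn (T j) (Ici 0)) (hTc : ∀ j, ConvexOn ℝ (Ici 0) (T j))
    (hT1 : ∀ j, T j 1 = 0) (hsum : ∑ j, Real.exp (P j) = 1)
    (Φ : ℝ → ℝ → ℝ)
    (hΦ : ∀ s q, Φ s q = ∑ j, Real.exp (q * P j + T j q * A j + s * D j)) :
    (∀ q : ℝ, 0 ≤ q → ∃! s : ℝ, Φ s q = 1) ∧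
      (∀ γk : ℝ → ℝ, (∀ q : ℝ, 0 ≤ q → Φ (γk q) q = 1) →
        StrictAntiOn γk (Set.Ici 0) ∧
        ContinuousOn γk (Set.Ioi 0) ∧
        (γk 1 = 0 ∧ Tendsto γk atTop atBot) ∧
        ConvexOn ℝ (Set.Ioi 0) γk) := by
  have hanti : ∀ q, StrictAnti (fun s => Φ s q) := by
    intro q s s' h
    simp only [hΦ]
    refine Finset.sum_lt_sum_of_nonempty Finset.univ_nonempty fun j _ => ?_
    rw [Real.exp_lt_exp]
    nlinarith [hD j]
  have hcont : ∀ q, Continuous (fun s => Φ s q) := by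
    intro q
    simp only [hΦ]
    fun_prop
  refine ⟨?_, ?_⟩
  · intro q hq
    have h0 : Tendsto (fun s => Φ s q) atTop (nhds 0) := by
      simp only [hΦ]
      rw [show (0:ℝ) = ∑ j : J, (0:ℝ) by simp]
      refine tendsto_finsetSum _ fun j _ => ?_
      refine Real.tendsto_exp_atBot.comp ?_
      exact tendsto_atBot_add_const_left _ _ (tendsto_id.atTop_mul_const_of_neg (hD j))
    have h1 : Tendsto (fun s => Φ s q) atBot atTop := by
      obtain ⟨j⟩ := ‹Nonempty J›
      have : Tendsto (fun s : ℝ => Real.exp (q * P j + T j q * A j + s * D j)) atBot atTop := by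
        refine Real.tendsto_exp_atTop.comp ?_
        exact tendsto_atTop_add_const_left _ _ (tendsto_id.atBot_mul_const_of_neg (hD j))
      refine tendsto_atTop_mono (fun s => ?_) this
      simp only [hΦ]
      exact Finset.single_le_sum (f := fun j => Real.exp (q * P j + T j q * A j + s * D j))
        (fun i _ => (Real.exp_pos _).le) (Finset.mem_univ j)
    obtain ⟨a, ha⟩ := (h0.eventually (gt_mem_nhds (zero_lt_one))).exists
    obtain ⟨b, hb⟩ := (h1.eventually (eventually_ge_atTop 1)).exists
    obtain ⟨s, hs⟩ := mem_range_of_exists_le_of_exists_ge (hcont q) ⟨a, ha.le⟩ ⟨b, hb⟩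
    exact ⟨s, hs, fun y hy => (hanti q).injective (hy.trans hs.symm)⟩
  · intro g hg
    have hconv : ConvexOn ℝ (Ioi 0) g := by
      refine ⟨convex_Ioi 0, ?_⟩
      intro x hx y hy a b ha hb hab
      simp only [mem_Ioi, smul_eq_mul] at *
      have hxy : 0 ≤ a * x + b * y := by positivity
      refine ((hanti (a * x + b * y)).le_iff_ge).1 ?_
      try simp only
      rw [hg _ hxy]
      have e1 := hg x hx.le
      have e2 := hg y hy.le
      calc Φ (a * g x + b * g y) (a * x + b * y)
          ≤ a * Φ (g x) x + b * Φ (g y) y := by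
            simp only [hΦ, Finset.mul_sum, ← Finset.sum_add_distrib]
            refine Finset.sum_le_sum fun j _ => ?_
            have c1 := (hTc j).2 (mem_Ici.2 hx.le) (mem_Ici.2 hy.le) ha hb hab
            simp only [smul_eq_mul] at c1
            have c2 := convexOn_exp.2 (mem_univ (x * P j + T j x * A j + g x * D j))
              (mem_univ (y * P j + T j y * A j + g y * D j)) ha hb hab
            simp only [smul_eq_mul] at c2
            refine le_trans (Real.exp_le_exp.2 ?_) c2
            nlinarith [mul_le_mul_of_nonneg_right c1 (hA j)]
        _ = 1 := by rw [e1, e2]; linarith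
    refine ⟨?_, hconv.continuousOn isOpen_Ioi, ⟨?_, ?_⟩, hconv⟩
    · intro x hx y hy hxy
      refine ((hanti y).lt_iff_gt).1 ?_
      try simp only
      rw [hg y hy, ← hg x hx]
      simp only [hΦ]
      refine Finset.sum_lt_sum_of_nonempty Finset.univ_nonempty fun j _ => ?_
      rw [Real.exp_lt_exp]
      nlinarith [hP j, mul_le_mul_of_nonneg_right (hTa j hx hy hxy.le) (hA j)]
    · refine (hanti 1).injective ?_
      try simp only
      rw [hg 1 zero_le_one, hΦ]
      simp [hT1, hsum]
    · rw [tendsto_atBot]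
      intro s
      have h0 : Tendsto (fun q => ∑ j, Real.exp (q * P j + s * D j)) atTop (nhds 0) := by
        rw [show (0:ℝ) = ∑ j : J, (0:ℝ) by simp]
        refine tendsto_finsetSum _ fun j _ => ?_
        refine Real.tendsto_exp_atBot.comp ?_
        exact tendsto_atBot_add_const_right _ _ (tendsto_id.atTop_mul_const_of_neg (hP j))
      filter_upwards [h0.eventually (gt_mem_nhds (zero_lt_one)), eventually_ge_atTop 1] with q h1 h2
      refine ((hanti q).le_iff_ge).1 ?_
      try simp only
      rw [hg q (by linarith)]
      refine le_trans ?_ h1.le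
      rw [hΦ]
      refine Finset.sum_le_sum fun j _ => Real.exp_le_exp.2 ?_
      have := hTa j (mem_Ici.2 zero_le_one) (mem_Ici.2 (by linarith : (0:ℝ) ≤ q)) h2
      rw [hT1] at this
      nlinarith [mul_nonpos_of_nonpos_of_nonneg this (hA j)]

/-- covering bound -/
lemma cover_bound (ν : Measure ℝ) [IsProbabilityMeasure ν] (M : ℝ) (hM : 0 ≤ M)
    (hν : ν (Icc (-M) M)ᶜ = 0) (δ : ℝ) (hδ : 0 < δ) (hδ1 : δ < 1) :
    ∫⁻ x, (ν (Metric.ball x δ))⁻¹ ∂ν ≤ ENNReal.ofReal ((2 * M + 2) / δ) := by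
  set s := Finset.Icc ⌊-M / δ⌋ ⌊M / δ⌋ with hs
  let U : ℤ → Set ℝ := fun n => {x | ⌊x / δ⌋ = n}
  have hU : ∀ n, MeasurableSet (U n) := fun n =>
    (Int.measurable_floor.comp (measurable_id.div_const δ)) (measurableSet_singleton n)
  have hsub : Icc (-M) M ⊆ ⋃ n ∈ s, U n := by
    intro x hx
    simp only [mem_iUnion]
    refine ⟨⌊x / δ⌋, ?_, rfl⟩
    rw [hs, Finset.mem_Icc]
    exact ⟨Int.floor_le_floor (by gcongr; exact hx.1), Int.floor_le_floor (by gcongr; exact hx.2)⟩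
  have hres : ν.restrict (⋃ n ∈ s, U n) = ν := by
    rw [Measure.restrict_eq_self_of_ae_mem]
    rw [ae_iff]
    exact measure_mono_null (fun x hx h => hx (hsub h)) hν
  calc ∫⁻ x, (ν (Metric.ball x δ))⁻¹ ∂ν = ∫⁻ x in ⋃ n ∈ s, U n, (ν (Metric.ball x δ))⁻¹ ∂ν := by
        rw [hres]
    _ = ∑ n ∈ s, ∫⁻ x in U n, (ν (Metric.ball x δ))⁻¹ ∂ν := by
        refine lintegral_biUnion_finset ?_ (fun n _ => hU n) _
        intro a _ b _ hab
        refine Set.disjoint_left.2 fun x hx hy => hab ?_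
        exact hx.symm.trans hy
    _ ≤ ∑ n ∈ s, 1 := by
        refine Finset.sum_le_sum fun n _ => ?_
        calc ∫⁻ x in U n, (ν (Metric.ball x δ))⁻¹ ∂ν ≤ ∫⁻ x in U n, (ν (U n))⁻¹ ∂ν := by
              refine setLIntegral_mono' (hU n) fun x hx => ?_
              refine ENNReal.inv_le_inv.2 (measure_mono fun y hy => ?_)
              have h1 : |y / δ - x / δ| < 1 := by
                apply Int.abs_sub_lt_one_of_floor_eq_floor
                exact Eq.trans hy (Eq.symm hx)
              rw [← sub_div, abs_div, abs_of_pos hδ, div_lt_one hδ] at h1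
              rwa [Metric.mem_ball, Real.dist_eq]
          _ ≤ 1 := by
              rw [setLIntegral_const]
              exact ENNReal.inv_mul_le_one _
    _ = ENNReal.ofReal (s.card : ℝ) := by simp
    _ ≤ _ := by
        refine ENNReal.ofReal_le_ofReal ?_
        rw [hs, Int.card_Icc]
        have h1 : ⌊-M / δ⌋ ≤ ⌊M / δ⌋ := Int.floor_le_floor (by gcongr; linarith)
        have h2 : ((⌊M / δ⌋ + 1 - ⌊-M / δ⌋).toNat : ℝ) = ⌊M / δ⌋ + 1 - ⌊-M / δ⌋ := by
          have : ((⌊M / δ⌋ + 1 - ⌊-M / δ⌋).toNat : ℤ) = ⌊M / δ⌋ + 1 - ⌊-M / δ⌋ :=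
            Int.toNat_of_nonneg (by omega)
          exact_mod_cast this
        rw [h2]
        have h3 := Int.floor_le (M / δ)
        have h4 := Int.lt_floor_add_one (-M / δ)
        have h5 : 1 ≤ 1 / δ := by rw [le_div_iff₀ hδ]; linarith
        have h6 : (2 * M + 2) / δ = M / δ - (-M / δ) + 2 * (1 / δ) := by ring
        linarith

/-- the function log of the q-moment -/
noncomputable def logMom (ν : Measure ℝ) (δ q : ℝ) : ℝ :=
  Real.log (∫ x, (ν (Metric.ball x δ)).toReal ^ (q - 1) ∂ν)

lemma meas_ball (ν : Measure ℝ) [IsProbabilityMeasure ν] (δ : ℝ) :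
    Measurable (fun x => ν (Metric.ball x δ)) := by
  have : MeasurableSet {z : ℝ × ℝ | dist z.2 z.1 < δ} :=
    (isOpen_lt (continuous_snd.dist continuous_fst) continuous_const).measurableSet
  exact measurable_measure_prodMk_left (ν := ν) this

lemma ae_pos (ν : Measure ℝ) [IsProbabilityMeasure ν] (M : ℝ) (hM : 0 ≤ M)
    (hν : ν (Icc (-M) M)ᶜ = 0) (δ : ℝ) (hδ : 0 < δ) (hδ1 : δ < 1) : ∀ᵐ x ∂ν, 0 < (ν (Metric.ball x δ)).toReal ∧ (ν (Metric.ball x δ)).toReal ≤ 1 := by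
  have h := ae_lt_top (meas_ball ν δ).inv
    ((cover_bound ν M hM hν δ hδ hδ1).trans_lt ENNReal.ofReal_lt_top).ne
  filter_upwards [h] with x hx
  simp only [Pi.inv_apply, ENNReal.inv_lt_top] at hx
  refine ⟨ENNReal.toReal_pos hx.ne' (measure_ne_top _ _), ?_⟩
  exact ENNReal.toReal_le_of_le_ofReal zero_le_one (by simpa using prob_le_one)

lemma int_inv (ν : Measure ℝ) [IsProbabilityMeasure ν] (M : ℝ) (hM : 0 ≤ M)
    (hν : ν (Icc (-M) M)ᶜ = 0) (δ : ℝ) (hδ : 0 < δ) (hδ1 : δ < 1) : Integrable (fun x => (ν (Metric.ball x δ)).toReal⁻¹) ν ∧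
    ∫ x, (ν (Metric.ball x δ)).toReal⁻¹ ∂ν ≤ (2 * M + 2) / δ := by
  have hb := cover_bound ν M hM hν δ hδ hδ1
  have hlt := hb.trans_lt ENNReal.ofReal_lt_top
  have hm : Measurable (fun x => (ν (Metric.ball x δ))⁻¹) := (meas_ball ν δ).inv
  have e : (fun x => (ν (Metric.ball x δ)).toReal⁻¹) = fun x => ((ν (Metric.ball x δ))⁻¹).toReal := by
    ext x; rw [ENNReal.toReal_inv]
  rw [e]
  refine ⟨integrable_toReal_of_lintegral_ne_top hm.aemeasurable hlt.ne, ?_⟩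
  rw [integral_toReal hm.aemeasurable (ae_lt_top hm hlt.ne)]
  exact ENNReal.toReal_le_of_le_ofReal (by positivity) hb

lemma int_pow (ν : Measure ℝ) [IsProbabilityMeasure ν] (M : ℝ) (hM : 0 ≤ M)
    (hν : ν (Icc (-M) M)ᶜ = 0) (δ : ℝ) (hδ : 0 < δ) (hδ1 : δ < 1) (q : ℝ) (hq : 0 ≤ q) :
    Integrable (fun x => (ν (Metric.ball x δ)).toReal ^ (q - 1)) ν := by
  refine (int_inv ν M hM hν δ hδ hδ1).1.mono'
    ((meas_ball ν δ).ennreal_toReal.pow_const _).aestronglyMeasurable ?_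
  filter_upwards [ae_pos ν M hM hν δ hδ hδ1] with x hx
  rw [Real.norm_of_nonneg (Real.rpow_nonneg hx.1.le _), ← Real.rpow_neg_one]
  exact Real.rpow_le_rpow_of_exponent_ge hx.1 hx.2 (by linarith)

lemma mom_pos (ν : Measure ℝ) [IsProbabilityMeasure ν] (M : ℝ) (hM : 0 ≤ M)
    (hν : ν (Icc (-M) M)ᶜ = 0) (δ : ℝ) (hδ : 0 < δ) (hδ1 : δ < 1) (q : ℝ) (hq : 0 ≤ q) :
    0 < ∫ x, (ν (Metric.ball x δ)).toReal ^ (q - 1) ∂ν := by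
  have e : (fun x => (ν (Metric.ball x δ)).toReal ^ (q - 1)) =ᵐ[ν]
      fun x => Real.exp (Real.log (ν (Metric.ball x δ)).toReal * (q - 1)) := by
    filter_upwards [ae_pos ν M hM hν δ hδ hδ1] with x hx
    rw [Real.rpow_def_of_pos hx.1]
  rw [integral_congr_ae e]
  exact integral_exp_pos ((integrable_congr e).1 (int_pow ν M hM hν δ hδ hδ1 q hq))

lemma logMom_anti (ν : Measure ℝ) [IsProbabilityMeasure ν] (M : ℝ) (hM : 0 ≤ M)
    (hν : ν (Icc (-M) M)ᶜ = 0) (δ : ℝ) (hδ : 0 < δ) (hδ1 : δ < 1) : AntitoneOn (logMom ν δ) (Ici 0) := by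
  intro x hx y hy hxy
  refine Real.log_le_log (mom_pos ν M hM hν δ hδ hδ1 y hy) ?_
  refine integral_mono_ae (int_pow ν M hM hν δ hδ hδ1 y hy) (int_pow ν M hM hν δ hδ hδ1 x hx) ?_
  filter_upwards [ae_pos ν M hM hν δ hδ hδ1] with z hz
  exact Real.rpow_le_rpow_of_exponent_ge hz.1 hz.2 (by linarith)

lemma logMom_one (ν : Measure ℝ) [IsProbabilityMeasure ν] (δ : ℝ) : logMom ν δ 1 = 0 := by
  simp [logMom]

lemma logMom_convex (ν : Measure ℝ) [IsProbabilityMeasure ν] (M : ℝ) (hM : 0 ≤ M)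
    (hν : ν (Icc (-M) M)ᶜ = 0) (δ : ℝ) (hδ : 0 < δ) (hδ1 : δ < 1) : ConvexOn ℝ (Ici 0) (logMom ν δ) := by
  refine ⟨convex_Ici 0, ?_⟩
  intro x hx y hy a b ha hb hab
  simp only [mem_Ici, smul_eq_mul] at *
  have hxy : 0 ≤ a * x + b * y := by positivity
  have pX := mom_pos ν M hM hν δ hδ hδ1 x hx
  have pY := mom_pos ν M hM hν δ hδ hδ1 y hy
  have pZ := mom_pos ν M hM hν δ hδ hδ1 _ hxy
  have iX := int_pow ν M hM hν δ hδ hδ1 x hx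
  have iY := int_pow ν M hM hν δ hδ hδ1 y hy
  have iZ := int_pow ν M hM hν δ hδ hδ1 _ hxy
  unfold logMom
  set X := ∫ x_1, (ν (Metric.ball x_1 δ)).toReal ^ (x - 1) ∂ν
  set Y := ∫ x_1, (ν (Metric.ball x_1 δ)).toReal ^ (y - 1) ∂ν
  set Z := ∫ x_1, (ν (Metric.ball x_1 δ)).toReal ^ (a * x + b * y - 1) ∂ν with hZ
  have hW : 0 < X ^ a * Y ^ b := by positivity
  rw [← Real.log_rpow pX, ← Real.log_rpow pY,
    ← Real.log_mul (by positivity) (by positivity)]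
  refine Real.log_le_log pZ ?_
  have key : ∫ z, (ν (Metric.ball z δ)).toReal ^ (a * x + b * y - 1) / (X ^ a * Y ^ b) ∂ν
      ≤ ∫ z, (a * ((ν (Metric.ball z δ)).toReal ^ (x - 1) / X) +
        b * ((ν (Metric.ball z δ)).toReal ^ (y - 1) / Y)) ∂ν := by
    refine integral_mono_ae (iZ.div_const _)
      (((iX.div_const _).const_mul _).add ((iY.div_const _).const_mul _)) ?_
    filter_upwards [ae_pos ν M hM hν δ hδ hδ1] with z hz
    obtain ⟨hz, -⟩ := hz
    set m := (ν (Metric.ball z δ)).toReal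
    have := Real.geom_mean_le_arith_mean2_weighted ha hb
      (p₁ := m ^ (x - 1) / X) (p₂ := m ^ (y - 1) / Y) (by positivity) (by positivity) hab
    refine le_trans (le_of_eq ?_) this
    rw [Real.div_rpow (by positivity) pX.le, Real.div_rpow (by positivity) pY.le,
      ← Real.rpow_mul hz.le, ← Real.rpow_mul hz.le, div_mul_div_comm, ← Real.rpow_add hz]
    congr 2
    linear_combination hab
  rw [integral_div, integral_add ((iX.div_const _).const_mul _) ((iY.div_const _).const_mul _),
    integral_const_mul, integral_const_mul, integral_div, integral_div] at key
  rw [div_self pX.ne', div_self pY.ne', mul_one, mul_one, hab, div_le_one hW] at key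
  exact key

lemma logMom_bounds (ν : Measure ℝ) [IsProbabilityMeasure ν] (M : ℝ) (hM : 0 ≤ M)
    (hν : ν (Icc (-M) M)ᶜ = 0) (δ : ℝ) (hδ : 0 < δ) (hδ1 : δ < 1) (q : ℝ) (hq : 0 ≤ q) :
    -q * (Real.log (2 * M + 2) - Real.log δ) ≤ logMom ν δ q ∧
      logMom ν δ q ≤ Real.log (2 * M + 2) - Real.log δ := by
  have hanti := logMom_anti ν M hM hν δ hδ hδ1
  have hconv := logMom_convex ν M hM hν δ hδ hδ1
  have h1 := logMom_one ν δ
  have h0 : logMom ν δ 0 ≤ Real.log (2 * M + 2) - Real.log δ := by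
    rw [← Real.log_div (by positivity) hδ.ne']
    refine Real.log_le_log (mom_pos ν M hM hν δ hδ hδ1 0 le_rfl) ?_
    have := (int_inv ν M hM hν δ hδ hδ1).2
    simpa [Real.rpow_neg_one] using this
  have h00 : 0 ≤ logMom ν δ 0 := by
    have := hanti (mem_Ici.2 le_rfl) (mem_Ici.2 zero_le_one) zero_le_one
    rwa [h1] at this
  refine ⟨?_, (hanti (mem_Ici.2 le_rfl) (mem_Ici.2 hq) hq).trans h0⟩
  have hlow : -q * logMom ν δ 0 ≤ logMom ν δ q := by
    rcases le_total q 1 with hq1 | hq1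
    · have := hanti (mem_Ici.2 hq) (mem_Ici.2 zero_le_one) hq1
      rw [h1] at this
      nlinarith
    · have hq0 : 0 < q := by linarith
      have := hconv.2 (mem_Ici.2 hq) (mem_Ici.2 (le_refl (0:ℝ)))
        (by positivity : 0 ≤ 1 / q)
        (by rw [sub_nonneg, div_le_one hq0]; exact hq1 : 0 ≤ 1 - 1 / q) (by ring)
      simp only [smul_eq_mul, mul_zero, add_zero, one_div, inv_mul_cancel₀ hq0.ne', h1] at this
      have h2 := mul_le_mul_of_nonneg_left this hq
      have h3 : q * (q⁻¹ * logMom ν δ q + (1 - q⁻¹) * logMom ν δ 0) =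
        logMom ν δ q + (q - 1) * logMom ν δ 0 := by field_simp
      rw [h3] at h2
      nlinarith
  nlinarith

lemma tendsto_spec (ν : Measure ℝ) [IsProbabilityMeasure ν] (M : ℝ) (hM : 0 ≤ M)
    (hν : ν (Icc (-M) M)ᶜ = 0) (q t : ℝ) (hq : 0 ≤ q)
    (h1 : liminf (fun δ : ℝ => logMom ν δ q / (-Real.log δ)) (nhdsWithin 0 (Set.Ioi 0)) = t)
    (h2 : limsup (fun δ : ℝ => logMom ν δ q / (-Real.log δ)) (nhdsWithin 0 (Set.Ioi 0)) = t) :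
    Tendsto (fun δ : ℝ => logMom ν δ q / (-Real.log δ)) (nhdsWithin 0 (Set.Ioi 0)) (nhds t) := by
  have hev : ∀ᶠ δ : ℝ in nhdsWithin 0 (Set.Ioi 0), δ ∈ Ioo (0:ℝ) (Real.exp (-1)) :=
    Ioo_mem_nhdsGT (Real.exp_pos _)
  have key : ∀ δ ∈ Ioo (0:ℝ) (Real.exp (-1)),
      -q * (Real.log (2 * M + 2) + 1) ≤ logMom ν δ q / (-Real.log δ) ∧
      logMom ν δ q / (-Real.log δ) ≤ Real.log (2 * M + 2) + 1 := by
    intro δ hδ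
    have hl : 1 ≤ -Real.log δ := by
      have := Real.log_le_log hδ.1 hδ.2.le
      rw [Real.log_exp] at this
      linarith
    have hδ1 : δ < 1 := hδ.2.trans (by rw [Real.exp_lt_one_iff]; norm_num)
    obtain ⟨b1, b2⟩ := logMom_bounds ν M hM hν δ hδ.1 hδ1 q hq
    have hC : 0 ≤ Real.log (2 * M + 2) := Real.log_nonneg (by linarith)
    have h3 : Real.log (2 * M + 2) - Real.log δ ≤ (Real.log (2 * M + 2) + 1) * (-Real.log δ) := by
      nlinarith
    rw [le_div_iff₀ (by linarith), div_le_iff₀ (by linarith)]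
    refine ⟨?_, by linarith⟩
    nlinarith
  refine tendsto_of_liminf_eq_limsup h1 h2 ?_ ?_
  · exact ⟨_, eventually_map.2 (hev.mono fun δ hδ => (key δ hδ).2)⟩
  · exact ⟨_, eventually_map.2 (hev.mono fun δ hδ => (key δ hδ).1)⟩

lemma tau_props (ν : Measure ℝ) [IsProbabilityMeasure ν] (M : ℝ) (hM : 0 ≤ M)
    (hν : ν (Icc (-M) M)ᶜ = 0) (τ : ℝ → ℝ)
    (h : ∀ q, 0 ≤ q → Tendsto (fun δ : ℝ => logMom ν δ q / (-Real.log δ))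
      (nhdsWithin 0 (Set.Ioi 0)) (nhds (τ q))) :
    AntitoneOn τ (Ici 0) ∧ ConvexOn ℝ (Ici 0) τ ∧ τ 1 = 0 := by
  have hev : ∀ᶠ δ : ℝ in nhdsWithin 0 (Set.Ioi 0), δ ∈ Ioo (0:ℝ) 1 :=
    Ioo_mem_nhdsGT zero_lt_one
  have hl : ∀ δ ∈ Ioo (0:ℝ) 1, 0 < -Real.log δ := fun δ hδ => by
    have := Real.log_neg hδ.1 hδ.2
    linarith
  refine ⟨?_, ⟨convex_Ici 0, ?_⟩, ?_⟩
  · intro x hx y hy hxy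
    refine le_of_tendsto_of_tendsto (h y hy) (h x hx) (hev.mono fun δ hδ => ?_)
    exact div_le_div_of_nonneg_right (logMom_anti ν M hM hν δ hδ.1 hδ.2 hx hy hxy) (hl δ hδ).le
  · intro x hx y hy a b ha hb hab
    have hz : a • x + b • y ∈ Ici (0:ℝ) := convex_Ici 0 hx hy ha hb hab
    refine le_of_tendsto_of_tendsto (h _ hz)
      (((h x hx).const_mul a).add ((h y hy).const_mul b)) (hev.mono fun δ hδ => ?_)
    have := div_le_div_of_nonneg_right
      ((logMom_convex ν M hM hν δ hδ.1 hδ.2).2 hx hy ha hb hab) (hl δ hδ).le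
    simp only [smul_eq_mul] at this ⊢
    refine this.trans (le_of_eq ?_)
    ring
  · refine tendsto_nhds_unique (h 1 zero_le_one) ?_
    simp [logMom_one]

lemma dims_mem {ι : Type} (B : IFSData ι)
    (hc : ∀ i, B.c i ∈ Set.Ioo (0 : ℝ) 1) (hd : ∀ i, B.d i ∈ Set.Ioo (0 : ℝ) 1) (l : List ι) :
    (0 < (B.dims l).1 ∧ (B.dims l).1 ≤ 1) ∧ (0 < (B.dims l).2 ∧ (B.dims l).2 ≤ 1) ∧
      (l ≠ [] → (B.dims l).1 < 1) := by
  induction l with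
  | nil => simp [IFSData.dims]
  | cons i l ih =>
    obtain ⟨⟨a1, a2⟩, ⟨b1, b2⟩, -⟩ := ih
    have e : B.dims (i :: l) = (B.c i * (if B.swap i then (B.dims l).2 else (B.dims l).1),
      B.d i * (if B.swap i then (B.dims l).1 else (B.dims l).2)) := rfl
    obtain ⟨c1, c2⟩ := hc i
    obtain ⟨d1, d2⟩ := hd i
    rw [e]
    by_cases hs : B.swap i = true
    · simp only [hs, if_true]
      refine ⟨⟨by positivity, by nlinarith⟩, ⟨by positivity, by nlinarith⟩, fun _ => by nlinarith⟩
    · simp only [hs]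
      refine ⟨⟨by simpa using mul_pos c1 a1, ?_⟩, ⟨by simpa using mul_pos d1 b1, ?_⟩, fun _ => ?_⟩ <;>
        simp <;> nlinarith

lemma wordProb_mem {ι : Type} (p : ι → ℝ) (hp : ∀ i, p i ∈ Set.Ioo (0 : ℝ) 1) (l : List ι) :
    0 < wordProb p l ∧ wordProb p l ≤ 1 ∧ (l ≠ [] → wordProb p l < 1) := by
  induction l with
  | nil => simp [wordProb]
  | cons i l ih =>
    obtain ⟨a1, a2, -⟩ := ih
    have e : wordProb p (i :: l) = p i * wordProb p l := by simp [wordProb]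
    obtain ⟨c1, c2⟩ := hp i
    rw [e]
    exact ⟨by positivity, by nlinarith, fun _ => by nlinarith⟩

lemma marginal_props (ν : Measure ℝ) [IsProbabilityMeasure ν] (K : Set ℝ) (hK : IsCompact K)
    (hν : ν Kᶜ = 0) (τ : ℝ → ℝ) (h : ∀ q : ℝ, 0 ≤ q → IsLqSpec ν q (τ q)) :
    AntitoneOn τ (Ici 0) ∧ ConvexOn ℝ (Ici 0) τ ∧ τ 1 = 0 := by
  obtain ⟨M, hM0, hM⟩ := hK.isBounded.subset_closedBall_lt 0 0
  rw [Real.closedBall_eq_Icc, zero_sub, zero_add] at hM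
  have hν' : ν (Icc (-M) M)ᶜ = 0 := measure_mono_null (compl_subset_compl.2 hM) hν
  exact tau_props ν M hM0.le hν' τ fun q hq =>
    tendsto_spec ν M hM0.le hν' q _ hq (h q hq).1 (h q hq).2

theorem properties_of_gamma_k
    {ι : Type} [Fintype ι] [Nonempty ι] (hcard : 2 ≤ Fintype.card ι)
    (B : IFSData ι)
    (hc : ∀ i, B.c i ∈ Set.Ioo (0 : ℝ) 1) (hd : ∀ i, B.d i ∈ Set.Ioo (0 : ℝ) 1)
    (p : ι → ℝ) (hp : ∀ i, p i ∈ Set.Ioo (0 : ℝ) 1) (hpsum : ∑ i : ι, p i = 1)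
    (μ : Measure (ℝ × ℝ)) [IsProbabilityMeasure μ]
    (hcpt : ∃ K : Set (ℝ × ℝ), IsCompact K ∧ μ Kᶜ = 0)
    (hself : μ = ∑ i : ι, ENNReal.ofReal (p i) • Measure.map (B.S i) μ)
    (τ1 τ2 : ℝ → ℝ)
    (hτ1 : ∀ q : ℝ, 0 ≤ q → IsLqSpec (Measure.map Prod.fst μ) q (τ1 q))
    (hτ2 : ∀ q : ℝ, 0 ≤ q → IsLqSpec (Measure.map Prod.snd μ) q (τ2 q))
     :
    ∀ k : ℕ, 1 ≤ k →
      (∀ q : ℝ, 0 ≤ q → ∃! s : ℝ, PsiSV B p τ1 τ2 k s q = 1) ∧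
      (∀ γk : ℝ → ℝ, (∀ q : ℝ, 0 ≤ q → PsiSV B p τ1 τ2 k (γk q) q = 1) →
        StrictAntiOn γk (Set.Ici 0) ∧
        ContinuousOn γk (Set.Ioi 0) ∧
        (γk 1 = 0 ∧ Tendsto γk atTop atBot) ∧
        ConvexOn ℝ (Set.Ioi 0) γk) := by
  intro k hk
  obtain ⟨K, hK, hKμ⟩ := hcpt
  haveI : IsProbabilityMeasure (Measure.map Prod.fst μ) :=
    Measure.isProbabilityMeasure_map measurable_fst.aemeasurable
  haveI : IsProbabilityMeasure (Measure.map Prod.snd μ) :=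
    Measure.isProbabilityMeasure_map measurable_snd.aemeasurable
  have t1 := marginal_props (Measure.map Prod.fst μ) _ (hK.image continuous_fst) (by
    rw [Measure.map_apply measurable_fst (hK.image continuous_fst).measurableSet.compl]
    exact measure_mono_null (fun x hx hxK => hx ⟨x, hxK, rfl⟩) hKμ) τ1 hτ1
  have t2 := marginal_props (Measure.map Prod.snd μ) _ (hK.image continuous_snd) (by
    rw [Measure.map_apply measurable_snd (hK.image continuous_snd).measurableSet.compl]
    exact measure_mono_null (fun x hx hxK => hx ⟨x, hxK, rfl⟩) hKμ) τ2 hτ2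
  have hT : ∀ l : List ι, AntitoneOn (tauW B τ1 τ2 l) (Ici 0) ∧
      ConvexOn ℝ (Ici 0) (tauW B τ1 τ2 l) ∧ tauW B τ1 τ2 l 1 = 0 := by
    intro l
    by_cases hl : B.usesPi1 l
    · have : tauW B τ1 τ2 l = τ1 := by ext q; simp [tauW, hl]
      rw [this]; exact t1
    · have : tauW B τ1 τ2 l = τ2 := by ext q; simp [tauW, hl]
      rw [this]; exact t2
  have hne : ∀ f : Fin k → ι, List.ofFn f ≠ [] := by
    intro f h
    have := congrArg List.length h
    simp at this
    omega
  have ha2 : ∀ l, 0 < B.alpha2 l := fun l =>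
    lt_min (dims_mem B hc hd l).1.1 (dims_mem B hc hd l).2.1.1
  have ha12 : ∀ l, B.alpha2 l ≤ B.alpha1 l := fun l => min_le_max
  have ha1 : ∀ l, 0 < B.alpha1 l := fun l => (ha2 l).trans_le (ha12 l)
  have ha2' : ∀ l, l ≠ [] → B.alpha2 l < 1 := fun l hl =>
    (min_le_left _ _).trans_lt ((dims_mem B hc hd l).2.2 hl)
  refine gamma_core (J := Fin k → ι) (fun f => Real.log (wordProb p (List.ofFn f)))
    (fun f => Real.log (B.alpha1 (List.ofFn f)) - Real.log (B.alpha2 (List.ofFn f)))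
    (fun f => Real.log (B.alpha2 (List.ofFn f))) (fun f => tauW B τ1 τ2 (List.ofFn f))
    (fun f => Real.log_neg (wordProb_mem p hp _).1 ((wordProb_mem p hp _).2.2 (hne f)))
    (fun f => sub_nonneg.2 (Real.log_le_log (ha2 _) (ha12 _)))
    (fun f => Real.log_neg (ha2 _) (ha2' _ (hne f)))
    (fun f => (hT _).1) (fun f => (hT _).2.1) (fun f => (hT _).2.2) ?_ _ ?_
  · have e : ∀ f : Fin k → ι, Real.exp (Real.log (wordProb p (List.ofFn f))) = ∏ i, p (f i) := by
      intro f
      rw [Real.exp_log (wordProb_mem p hp _).1, wordProb, List.map_ofFn, List.prod_ofFn]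
      rfl
    simp only [e]
    have := Fintype.prod_sum (fun (_ : Fin k) (j : ι) => p j)
    rw [hpsum] at this
    simpa using this.symm
  · intro s q
    unfold PsiSV psiSV
    refine Finset.sum_congr rfl fun f _ => ?_
    rw [Real.rpow_def_of_pos (wordProb_mem p hp _).1, Real.rpow_def_of_pos (ha1 _),
      Real.rpow_def_of_pos (ha2 _), ← Real.exp_add, ← Real.exp_add]
    congr 1
    ring
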